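/- Let W(x) = ∑_{n=0}^{∞} cos(21ⁿ π x) / 3ⁿ be the Weierstrass function and define h : ℝ → ℝ by h(x) = W(x)·x·(x − 1) for x ∈ [0,1] and h(x) = 0 otherwise. Then h is continuous at every point of ℝ, h is differentiable at every point of ℝ \ [0,1], and h is differentiable at no point of the open interval (0,1); consequently both the set of differentiability points of h and its complement have cardinality 𝔠. -/

import Mathlib

/-- The Weierstrass function `W x = ∑_{n=0}^∞ cos(21ⁿ π x) / 3ⁿ`. -/
noncomputable def weierstrass : ℝ → ℝ := fun x =>
  ∑' n : ℕ, Real.cos (21 ^ n * Real.pi * x) / 3 ^ n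

theorem wsum (x : ℝ) : Summable fun n : ℕ => Real.cos (21 ^ n * Real.pi * x) / 3 ^ n := by
  refine Summable.of_norm_bounded (g := fun n : ℕ => ((1:ℝ)/3)^n)
    (summable_geometric_of_lt_one (by norm_num) (by norm_num)) (fun n => ?_)
  rw [Real.norm_eq_abs, abs_div, abs_of_pos (by positivity : (0:ℝ) < 3^n), one_div, inv_pow,
    ← one_div]
  gcongr
  exact Real.abs_cos_le_one _

theorem wcont : Continuous weierstrass := by
  unfold weierstrass
  refine continuous_tsum (u := fun n : ℕ => ((1:ℝ)/3)^n) (fun n => by fun_prop)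
    (summable_geometric_of_lt_one (by norm_num) (by norm_num)) (fun n x => ?_)
  rw [Real.norm_eq_abs, abs_div, abs_of_pos (by positivity : (0:ℝ) < 3^n), one_div, inv_pow,
    ← one_div]
  gcongr
  exact Real.abs_cos_le_one _

theorem cos_lip (a b : ℝ) : |Real.cos a - Real.cos b| ≤ |a - b| := by
  rw [Real.cos_sub_cos, abs_mul, abs_mul]
  have h1 := Real.abs_sin_le_one ((a + b) / 2)
  have h2 : |Real.sin ((a - b) / 2)| ≤ |(a - b) / 2| := Real.abs_sin_le_abs
  rw [abs_div] at h2
  norm_num at h2 ⊢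
  nlinarith [abs_nonneg (Real.sin ((a + b) / 2)), abs_nonneg (Real.sin ((a - b) / 2))]

theorem head_bound (x y : ℝ) (m : ℕ) :
    |∑ n ∈ Finset.range m, (Real.cos (21 ^ n * Real.pi * y) / 3 ^ n
      - Real.cos (21 ^ n * Real.pi * x) / 3 ^ n)| ≤ Real.pi * |y - x| * 7 ^ m / 6 := by
  have hp := Real.pi_pos
  have h : ∀ n ∈ Finset.range m, |Real.cos (21 ^ n * Real.pi * y) / 3 ^ n
      - Real.cos (21 ^ n * Real.pi * x) / 3 ^ n| ≤ Real.pi * |y - x| * 7 ^ n := by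
    intro n _
    rw [← sub_div, abs_div, abs_of_pos (by positivity : (0:ℝ) < 3^n), div_le_iff₀ (by positivity)]
    refine (cos_lip _ _).trans (le_of_eq ?_)
    rw [← mul_sub, abs_mul, abs_of_pos (by positivity : (0:ℝ) < 21 ^ n * Real.pi)]
    rw [show (21:ℝ) = 7 * 3 by norm_num, mul_pow]
    ring
  refine (Finset.abs_sum_le_sum_abs _ _).trans ((Finset.sum_le_sum h).trans ?_)
  rw [← Finset.mul_sum, geom_sum_eq (by norm_num)]
  have : 0 ≤ Real.pi * |y - x| := by positivity
  norm_num
  rw [← mul_div_assoc]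
  gcongr
  linarith

theorem cos_shift (α : ℤ) (k : ℕ) (t : ℝ) :
    Real.cos (21 ^ k * (α : ℝ) * Real.pi + t) = (-1) ^ α * Real.cos t := by
  have h := Real.cos_add_int_mul_pi t (21 ^ k * α)
  push_cast at h
  rw [add_comm, h, zpow_mul]
  congr 2
  have : Odd ((21:ℤ)^k) := Odd.pow (by decide)
  exact this.neg_one_zpow

theorem key (x : ℝ) (m : ℕ) : ∃ y, 0 < y - x ∧ y - x ≤ 2 / 21 ^ m ∧
    7 ^ m * (1/100) * (y - x) ≤ |weierstrass y - weierstrass x| := by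
  set α : ℤ := round (21 ^ m * x) with hα
  set r : ℝ := 21 ^ m * x - α with hr
  have hr1 : |r| ≤ 1/2 := abs_sub_round _
  obtain ⟨hr2, hr3⟩ := abs_le.mp hr1
  have hP : (0:ℝ) < 21 ^ m := by positivity
  set y : ℝ := (α + 1) / 21 ^ m with hy
  have hyx : y - x = (1 - r) / 21 ^ m := by rw [hy, hr]; field_simp; ring
  have hpos : 0 < y - x := by rw [hyx]; apply div_pos _ hP; linarith
  refine ⟨y, hpos, ?_, ?_⟩
  · rw [hyx]; gcongr; linarith
  set s : ℝ := (-1) ^ α with hs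
  have hs1 : |s| = 1 := by rw [hs, abs_zpow]; simp
  have hss : s * s = 1 := by rw [← abs_mul_abs_self, hs1]; norm_num
  have cx : ∀ k : ℕ, Real.cos (21 ^ (k + m) * Real.pi * x)
      = s * Real.cos (21 ^ k * Real.pi * r) := by
    intro k
    rw [← cos_shift α k, hr]; congr 1; ring
  have cy : ∀ k : ℕ, Real.cos (21 ^ (k + m) * Real.pi * y) = - s := by
    intro k
    have h1 := cos_shift (α + 1) k 0
    rw [zpow_add₀ (by norm_num), ← hs] at h1
    simp only [Real.cos_zero, zpow_one, mul_one, add_zero] at h1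
    rw [show -s = s * -1 by ring, ← h1]
    congr 1
    rw [hy, pow_add]; push_cast; field_simp
  have hsx := (summable_nat_add_iff m).mpr (wsum x)
  have hsy := (summable_nat_add_iff m).mpr (wsum y)
  have hW : weierstrass y - weierstrass x
      = ∑ n ∈ Finset.range m, (Real.cos (21 ^ n * Real.pi * y) / 3 ^ n
          - Real.cos (21 ^ n * Real.pi * x) / 3 ^ n)
        + ∑' k : ℕ, (Real.cos (21 ^ (k + m) * Real.pi * y) / 3 ^ (k + m)
          - Real.cos (21 ^ (k + m) * Real.pi * x) / 3 ^ (k + m)) := by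
    rw [hsy.tsum_sub hsx, Finset.sum_sub_distrib]
    unfold weierstrass
    rw [← (wsum y).sum_add_tsum_nat_add m, ← (wsum x).sum_add_tsum_nat_add m]
    ring
  set T := ∑' k : ℕ, (Real.cos (21 ^ (k + m) * Real.pi * y) / 3 ^ (k + m)
          - Real.cos (21 ^ (k + m) * Real.pi * x) / 3 ^ (k + m)) with hT
  have hsT : (1:ℝ) / 3 ^ m ≤ (-s) * T := by
    have hsum := (hsy.sub hsx).mul_left (-s)
    rw [hT, ← tsum_mul_left]
    have e : ∀ k : ℕ, -s * (Real.cos (21 ^ (k + m) * Real.pi * y) / 3 ^ (k + m)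
          - Real.cos (21 ^ (k + m) * Real.pi * x) / 3 ^ (k + m))
          = (1 + Real.cos (21 ^ k * Real.pi * r)) / 3 ^ (k + m) := by
      intro k
      rw [cx, cy]
      linear_combination ((1 + Real.cos (21 ^ k * Real.pi * r)) / 3 ^ (k + m)) * hss
    refine le_trans ?_ (hsum.le_tsum 0 (fun k _ => ?_))
    · rw [e]
      have : 0 ≤ Real.cos (21 ^ 0 * Real.pi * r) := by
        apply Real.cos_nonneg_of_neg_pi_div_two_le_of_le <;> nlinarith [Real.pi_pos]
      rw [zero_add]
      gcongr
      linarith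
    · rw [e]
      have := Real.neg_one_le_cos (21 ^ k * Real.pi * r)
      apply div_nonneg _ (by positivity)
      linarith
  have hTabs : (1:ℝ) / 3 ^ m ≤ |T| := by
    refine hsT.trans ((le_abs_self _).trans (le_of_eq ?_))
    rw [abs_mul, abs_neg, hs1, one_mul]
  have hH := head_bound x y m
  rw [abs_of_pos hpos] at hH
  have h3 : 7 ^ m * (y - x) * (2/3) ≤ 1 / 3 ^ m := by
    rw [hyx, show (21:ℝ) = 7 * 3 by norm_num, mul_pow]
    field_simp
    linarith
  rw [hW]
  set H := ∑ n ∈ Finset.range m, (Real.cos (21 ^ n * Real.pi * y) / 3 ^ n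
          - Real.cos (21 ^ n * Real.pi * x) / 3 ^ n)
  have h4 : |T| ≤ |H + T| + |H| := by
    have := abs_sub (H + T) H
    simpa using this
  have h5 : Real.pi * (y - x) * 7 ^ m / 6 ≤ 3.15 * (y - x) * 7 ^ m / 6 := by
    gcongr
    exact Real.pi_lt_d2.le
  have h6 : 0 < (y - x) * 7 ^ m := by positivity
  linarith

theorem wnd (x : ℝ) : ¬ DifferentiableAt ℝ weierstrass x := by
  intro hd
  obtain ⟨C, hC⟩ := hd.isBigO_sub.bound
  choose y h1 h2 h3 using key x
  have hlim : Filter.Tendsto y Filter.atTop (nhds x) := by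
    have h0 : Filter.Tendsto (fun m : ℕ => (2:ℝ) / 21 ^ m) Filter.atTop (nhds 0) :=
      Filter.Tendsto.div_atTop tendsto_const_nhds
        (tendsto_pow_atTop_atTop_of_one_lt (by norm_num))
    have := squeeze_zero (fun m => (h1 m).le) h2 h0
    simpa using this.add_const x
  have hA := hlim.eventually hC
  have hB := (tendsto_pow_atTop_atTop_of_one_lt (by norm_num : (1:ℝ) < 7)).eventually_gt_atTop
    (100 * C)
  obtain ⟨m, hm, hm'⟩ := (hA.and hB).exists
  rw [Real.norm_eq_abs, Real.norm_eq_abs, abs_of_pos (h1 m)] at hm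
  have := (h3 m).trans hm
  have := le_of_mul_le_mul_right this (h1 m)
  linarith



/-- Let `h x = W x · x · (x - 1)` for `x ∈ [0,1]` and `h x = 0` otherwise. Then `h` is
continuous everywhere, differentiable at every point of `ℝ \ [0,1]`, differentiable at no
point of `(0,1)`, and both its differentiability set and the complement have cardinality `𝔠`. -/
theorem stmt_14 (h : ℝ → ℝ)
    (hh : h = (Set.Icc (0 : ℝ) 1).indicator (fun x => weierstrass x * x * (x - 1))) :
    (∀ x : ℝ, ContinuousAt h x) ∧
    (∀ x : ℝ, x ∉ Set.Icc (0 : ℝ) 1 → DifferentiableAt ℝ h x) ∧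
    (∀ x ∈ Set.Ioo (0 : ℝ) 1, ¬ DifferentiableAt ℝ h x) ∧
    Cardinal.mk ↥{x : ℝ | DifferentiableAt ℝ h x} = Cardinal.continuum ∧
    Cardinal.mk ↥{x : ℝ | ¬ DifferentiableAt ℝ h x} = Cardinal.continuum := by
  have hdiff : ∀ x : ℝ, x ∉ Set.Icc (0 : ℝ) 1 → DifferentiableAt ℝ h x := by
    intro x hx
    have : h =ᶠ[nhds x] fun _ => 0 := by
      filter_upwards [isClosed_Icc.isOpen_compl.mem_nhds hx] with z hz
      rw [hh]; exact Set.indicator_of_notMem hz _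
    exact (differentiableAt_const (0:ℝ)).congr_of_eventuallyEq this
  have hnd : ∀ x ∈ Set.Ioo (0 : ℝ) 1, ¬ DifferentiableAt ℝ h x := by
    intro x hx hd
    apply wnd x
    have hne : x * (x - 1) ≠ 0 := mul_ne_zero hx.1.ne' (by linarith [hx.2])
    have hq : DifferentiableAt ℝ (fun z => h z / (z * (z - 1))) x :=
      hd.fun_div (by fun_prop) hne
    refine hq.congr_of_eventuallyEq ?_
    filter_upwards [isOpen_Ioo.mem_nhds hx] with z hz
    have hz0 : z ≠ 0 := hz.1.ne'
    have hz1 : z - 1 ≠ 0 := by linarith [hz.2]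
    rw [hh, Set.indicator_of_mem (Set.Ioo_subset_Icc_self hz)]
    field_simp
  refine ⟨?_, hdiff, hnd, ?_, ?_⟩
  · have : Continuous h := by
      rw [hh]
      refine continuous_indicator ?_ ?_
      · intro a ha
        rw [frontier_Icc zero_le_one] at ha
        rcases ha with rfl | rfl <;> simp
      · have := wcont
        exact Continuous.continuousOn (by fun_prop)
    exact fun x => this.continuousAt
  · apply le_antisymm
    · rw [← Cardinal.mk_real]; exact Cardinal.mk_set_le _
    · rw [← Cardinal.mk_Ioi_real 1]
      exact Cardinal.mk_le_mk_of_subset fun z hz => hdiff z fun h' => absurd h'.2 (not_le.mpr hz)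
  · apply le_antisymm
    · rw [← Cardinal.mk_real]; exact Cardinal.mk_set_le _
    · rw [← Cardinal.mk_Ioo_real (zero_lt_one (α := ℝ))]
      exact Cardinal.mk_le_mk_of_subset fun z hz => hnd z hz
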